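/- (Bernstein-Type Inequality, Lemma 2) Let B be an r×r complex Hermitian matrix, b ∈ ℂ^r, c ∈ ℝ, and ρ ∈ (0, 1]. Let x be a standard circularly symmetric complex Gaussian random vector in ℂ^r, i.e., the 2r real random variables Re(x_1), Im(x_1), …, Re(x_r), Im(x_r) are independent real Gaussians with mean 0 and variance 1/2. If Tr(B) − √(2 ln(1/ρ)) · √(‖B‖_F² + 2‖b‖₂²) + ln(ρ) · max(λ_max(−B), 0) + c ≥ 0, then Pr{ x^H B x + 2 Re(b^H x) + c ≥ 0 } ≥ 1 − ρ. -/

import Mathlib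

open Matrix MeasureTheory ProbabilityTheory

/-- The standard circularly symmetric complex Gaussian measure on `ℂʳ`: the pushforward to
`Fin r → ℂ` of the product measure on `(ℝ × ℝ)ʳ ≅ ℝ^{2r}` in which each real coordinate is an
independent real Gaussian with mean `0` and variance `1/2`. -/
noncomputable def stdComplexGaussian (r : ℕ) : Measure (Fin r → ℂ) :=
  Measure.map (fun f i => (⟨(f i).1, (f i).2⟩ : ℂ))
    (Measure.pi fun _ : Fin r =>
      (gaussianReal 0 (1 / 2)).prod (gaussianReal 0 (1 / 2)))

theorem neg_log_one_sub_le {x y : ℝ} (hxy : x ≤ y) (hy0 : 0 ≤ y) (hy1 : y < 1) :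
    -Real.log (1 - x) ≤ x + x ^ 2 / (2 * (1 - y)) := by
  rcases le_or_gt 0 x with hx | hx
  · have h1 : 0 < 1 - x := by linarith
    have h2 : -Real.log (1 - x) ≤ x + x ^ 2 / (2 * (1 - x)) := by
      have h := Real.self_le_sinh_iff.2 (Real.log_nonneg (x := (1 - x)⁻¹)
        ((one_le_inv₀ h1).2 (by linarith)))
      rw [Real.sinh_log (by positivity), Real.log_inv] at h
      refine h.trans (le_of_eq ?_)
      field_simp
      ring
    refine h2.trans ?_
    have : 0 < 1 - y := by linarith
    gcongr
  · have h1 := Real.le_log_one_add_of_nonneg (x := -x) (by linarith)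
    have h2 : -x - x ^ 2 / 2 ≤ 2 * -x / (-x + 2) := by
      rw [le_div_iff₀ (by linarith)]
      nlinarith [mul_nonneg (neg_nonneg.2 hx.le) (sq_nonneg x)]
    have h3 : x ^ 2 / 2 ≤ x ^ 2 / (2 * (1 - y)) := by
      have : 0 < 1 - y := by linarith
      gcongr
      linarith
    rw [sub_eq_add_neg]
    linarith

theorem gaussianReal_exp_quadratic {κ : ℝ} (hκ : κ < 1) (γ : ℝ) :
    Integrable (fun u => Real.exp (κ * u ^ 2 + γ * u)) (gaussianReal 0 (1 / 2)) ∧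
    ∫ u, Real.exp (κ * u ^ 2 + γ * u) ∂(gaussianReal 0 (1 / 2))
      = (Real.sqrt (1 - κ))⁻¹ * Real.exp (γ ^ 2 / (4 * (1 - κ))) := by
  have hk : 0 < 1 - κ := by linarith
  have key : ∀ u, gaussianPDFReal 0 (1 / 2) u * Real.exp (κ * u ^ 2 + γ * u)
      = ((Real.sqrt Real.pi)⁻¹ * Real.exp (γ ^ 2 / (4 * (1 - κ)))) *
        Real.exp (-(1 - κ) * (u - γ / (2 * (1 - κ))) ^ 2) := by
    intro u
    rw [gaussianPDFReal, mul_assoc (_)⁻¹, mul_assoc (_)⁻¹, ← Real.exp_add, ← Real.exp_add]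
    congr 2
    · push_cast
      ring_nf
    · push_cast
      field_simp
      ring
  constructor
  · rw [gaussianReal_of_var_ne_zero 0 (by norm_num : (1 / 2 : NNReal) ≠ 0),
      integrable_withDensity_iff_integrable_smul' (measurable_gaussianPDF _ _)
      (ae_of_all _ fun _ => gaussianPDF_lt_top)]
    simp only [toReal_gaussianPDF, smul_eq_mul, key]
    exact ((integrable_exp_neg_mul_sq hk).comp_sub_right _).const_mul _
  · rw [integral_gaussianReal_eq_integral_smul (by norm_num)]
    simp only [smul_eq_mul, key]
    rw [integral_const_mul,
      integral_sub_right_eq_self (fun u => Real.exp (-(1 - κ) * u ^ 2)), integral_gaussian,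
      Real.sqrt_div Real.pi_pos.le]
    have := Real.sqrt_pos.2 Real.pi_pos
    field_simp

theorem prod_gaussianReal_exp_quadratic {κ : ℝ} (hκ : κ < 1) (γ δ : ℝ) :
    Integrable (fun p : ℝ × ℝ =>
        Real.exp (κ * (p.1 ^ 2 + p.2 ^ 2) + (γ * p.1 + δ * p.2)))
      ((gaussianReal 0 (1 / 2)).prod (gaussianReal 0 (1 / 2))) ∧
    ∫ p : ℝ × ℝ, Real.exp (κ * (p.1 ^ 2 + p.2 ^ 2) + (γ * p.1 + δ * p.2))
        ∂((gaussianReal 0 (1 / 2)).prod (gaussianReal 0 (1 / 2)))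
      = (1 - κ)⁻¹ * Real.exp ((γ ^ 2 + δ ^ 2) / (4 * (1 - κ))) := by
  have hk : 0 < 1 - κ := by linarith
  have key : ∀ p : ℝ × ℝ, Real.exp (κ * (p.1 ^ 2 + p.2 ^ 2) + (γ * p.1 + δ * p.2)) =
      Real.exp (κ * p.1 ^ 2 + γ * p.1) * Real.exp (κ * p.2 ^ 2 + δ * p.2) := by
    intro p
    rw [← Real.exp_add]
    ring_nf
  obtain ⟨h1, h1'⟩ := gaussianReal_exp_quadratic hκ γ
  obtain ⟨h2, h2'⟩ := gaussianReal_exp_quadratic hκ δ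
  simp only [key]
  refine ⟨h1.mul_prod h2, ?_⟩
  rw [integral_prod_mul (fun u => Real.exp (κ * u ^ 2 + γ * u))
    (fun u => Real.exp (κ * u ^ 2 + δ * u)), h1', h2', add_div, Real.exp_add]
  have := Real.mul_self_sqrt hk.le
  rw [← this, mul_inv, this]
  ring

theorem measurable_toComplexVec (r : ℕ) :
    Measurable (fun (f : Fin r → ℝ × ℝ) i => (⟨(f i).1, (f i).2⟩ : ℂ)) := by
  refine measurable_pi_lambda _ fun i => ?_
  exact Complex.measurableEquivRealProd.symm.measurable.comp (measurable_pi_apply i)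

instance isProbabilityMeasure_stdComplexGaussian (r : ℕ) :
    IsProbabilityMeasure (stdComplexGaussian r) :=
  Measure.isProbabilityMeasure_map (measurable_toComplexVec r).aemeasurable

theorem integral_exp_re_dotProduct_stdComplexGaussian {r : ℕ} (w : Fin r → ℂ) :
    ∫ x, Complex.exp (((star w ⬝ᵥ x).re : ℂ) * Complex.I) ∂(stdComplexGaussian r)
      = Complex.exp (-((star w ⬝ᵥ w).re : ℂ) / 4) := by
  rw [stdComplexGaussian, integral_map (measurable_toComplexVec r).aemeasurable
    (Measurable.aestronglyMeasurable (by fun_prop))]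
  have key : ∀ f : Fin r → ℝ × ℝ, Complex.exp
      (((star w ⬝ᵥ fun i => (⟨(f i).1, (f i).2⟩ : ℂ)).re : ℂ) * Complex.I) =
      ∏ i, (fun p : ℝ × ℝ => Complex.exp (((w i).re : ℂ) * p.1 * Complex.I) *
        Complex.exp (((w i).im : ℂ) * p.2 * Complex.I)) (f i) := by
    intro f
    simp only [← Complex.exp_add, ← Complex.exp_sum]
    congr 1
    simp only [dotProduct, Complex.re_sum, Pi.star_apply, Complex.star_def, Complex.mul_re,
      Complex.conj_re, Complex.conj_im]
    push_cast
    rw [Finset.sum_mul]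
    exact Finset.sum_congr rfl fun i _ => by ring
  refine (integral_congr_ae (ae_of_all _ key)).trans ((integral_fintype_prod_eq_prod
    (fun i (p : ℝ × ℝ) => Complex.exp (((w i).re : ℂ) * p.1 * Complex.I) *
      Complex.exp (((w i).im : ℂ) * p.2 * Complex.I))).trans ?_)
  have hpair : ∀ i, ∫ p : ℝ × ℝ, Complex.exp (((w i).re : ℂ) * p.1 * Complex.I) *
        Complex.exp (((w i).im : ℂ) * p.2 * Complex.I)
        ∂((gaussianReal 0 (1 / 2)).prod (gaussianReal 0 (1 / 2))) =
      Complex.exp (-((star (w i) * w i).re : ℂ) / 4) := by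
    intro i
    rw [integral_prod_mul (fun u : ℝ => Complex.exp (((w i).re : ℂ) * u * Complex.I))
      (fun u : ℝ => Complex.exp (((w i).im : ℂ) * u * Complex.I)), ← charFun_apply_real,
      ← charFun_apply_real, charFun_gaussianReal, charFun_gaussianReal, ← Complex.exp_add]
    congr 1
    simp only [Complex.star_def, Complex.mul_re, Complex.conj_re, Complex.conj_im]
    push_cast
    ring
  simp only [hpair]
  rw [← Complex.exp_sum]
  congr 1
  simp only [dotProduct, Complex.re_sum, Pi.star_apply]
  push_cast
  rw [← Finset.sum_div, Finset.sum_neg_distrib]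

theorem exists_strongDual_eq_re_dotProduct {r : ℕ} (L : StrongDual ℝ (Fin r → ℂ)) :
    ∃ w : Fin r → ℂ, ∀ x, L x = (star w ⬝ᵥ x).re := by
  refine ⟨fun i => ⟨L (Pi.single i 1), L (Pi.single i Complex.I)⟩, fun x => ?_⟩
  have hx : x = ∑ i, ((x i).re • (Pi.single i 1 : Fin r → ℂ) +
      (x i).im • (Pi.single i Complex.I : Fin r → ℂ)) := by
    ext j
    simp [Finset.sum_apply, Pi.single_apply, Finset.sum_add_distrib]
  conv_lhs => rw [hx]
  simp only [map_sum, map_add, map_smul, dotProduct, Complex.re_sum, Pi.star_apply,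
    Complex.star_def, Complex.mul_re, Complex.conj_re, Complex.conj_im, smul_eq_mul]
  exact Finset.sum_congr rfl fun i _ => by ring

theorem star_mulVec_dotProduct {r : ℕ} (V : Matrix (Fin r) (Fin r) ℂ) (x y : Fin r → ℂ) :
    star (V *ᵥ x) ⬝ᵥ y = star x ⬝ᵥ (Vᴴ *ᵥ y) := by
  rw [star_mulVec, dotProduct_mulVec]

/-- The standard complex Gaussian measure is invariant under unitary transformations. -/
theorem map_mulVec_stdComplexGaussian {r : ℕ} {V : Matrix (Fin r) (Fin r) ℂ}
    (hV : V * Vᴴ = 1) :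
    (stdComplexGaussian r).map (fun x => V *ᵥ x) = stdComplexGaussian r := by
  have hm : Measurable (fun x : Fin r → ℂ => V *ᵥ x) :=
    (Continuous.matrix_mulVec continuous_const continuous_id).measurable
  have := Measure.isProbabilityMeasure_map (μ := stdComplexGaussian r) hm.aemeasurable
  refine Measure.ext_of_charFunDual (funext fun L => ?_)
  obtain ⟨w, hw⟩ := exists_strongDual_eq_re_dotProduct L
  have hshift : ∀ x, star w ⬝ᵥ (V *ᵥ x) = star (Vᴴ *ᵥ w) ⬝ᵥ x := fun x => by
    rw [star_mulVec_dotProduct, conjTranspose_conjTranspose]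
  simp only [charFunDual_apply, hw]
  rw [integral_map hm.aemeasurable (Measurable.aestronglyMeasurable (by fun_prop))]
  simp only [hshift]
  rw [integral_exp_re_dotProduct_stdComplexGaussian,
    integral_exp_re_dotProduct_stdComplexGaussian, ← hshift, mulVec_mulVec, hV, one_mulVec]

theorem stdComplexGaussian_exp_diagonal {r : ℕ} (a : Fin r → ℝ) (β : Fin r → ℂ) (t : ℝ)
    (ht : ∀ i, t * a i < 1) :
    Integrable (fun y : Fin r → ℂ =>
        Real.exp (t * ((∑ i, a i * ‖y i‖ ^ 2) - 2 * (star β ⬝ᵥ y).re))) (stdComplexGaussian r) ∧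
    ∫ y, Real.exp (t * ((∑ i, a i * ‖y i‖ ^ 2) - 2 * (star β ⬝ᵥ y).re)) ∂(stdComplexGaussian r)
      = ∏ i, ((1 - t * a i)⁻¹ * Real.exp (t ^ 2 * ‖β i‖ ^ 2 / (1 - t * a i))) := by
  have hm : Measurable (fun y : Fin r → ℂ =>
      Real.exp (t * ((∑ i, a i * ‖y i‖ ^ 2) - 2 * (star β ⬝ᵥ y).re))) := by fun_prop
  have key : ∀ f : Fin r → ℝ × ℝ,
      Real.exp (t * ((∑ i, a i * ‖(⟨(f i).1, (f i).2⟩ : ℂ)‖ ^ 2) -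
        2 * (star β ⬝ᵥ fun i => (⟨(f i).1, (f i).2⟩ : ℂ)).re)) =
      ∏ i, (fun p : ℝ × ℝ => Real.exp (t * a i * (p.1 ^ 2 + p.2 ^ 2) +
        ((-2 * t * (β i).re) * p.1 + (-2 * t * (β i).im) * p.2))) (f i) := by
    intro f
    simp only [← Real.exp_sum]
    congr 1
    simp only [dotProduct, Complex.re_sum, Pi.star_apply, Complex.star_def, Complex.mul_re,
      Complex.conj_re, Complex.conj_im, Complex.sq_norm, Complex.normSq_apply]
    rw [Finset.mul_sum, ← Finset.sum_sub_distrib, Finset.mul_sum]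
    exact Finset.sum_congr rfl fun i _ => by ring
  have hi := fun i => prod_gaussianReal_exp_quadratic (ht i) (-2 * t * (β i).re)
    (-2 * t * (β i).im)
  constructor
  · rw [stdComplexGaussian, integrable_map_measure hm.aestronglyMeasurable
      (measurable_toComplexVec r).aemeasurable]
    simp only [Function.comp_def, key]
    exact Integrable.fintype_prod fun i => (hi i).1
  · rw [stdComplexGaussian, integral_map (measurable_toComplexVec r).aemeasurable
      hm.aestronglyMeasurable]
    refine (integral_congr_ae (ae_of_all _ key)).trans ((integral_fintype_prod_eq_prod
      (fun i (p : ℝ × ℝ) => Real.exp (t * a i * (p.1 ^ 2 + p.2 ^ 2) +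
        ((-2 * t * (β i).re) * p.1 + (-2 * t * (β i).im) * p.2)))).trans ?_)
    refine Finset.prod_congr rfl fun i _ => ?_
    rw [(hi i).2, Complex.sq_norm, Complex.normSq_apply]
    have : 0 < 1 - t * a i := by linarith [ht i]
    congr 2
    field_simp
    ring

theorem integral_exp_diagonal_le {r : ℕ} (a : Fin r → ℝ) (β : Fin r → ℂ) {t l : ℝ}
    (ht : 0 ≤ t) (hl : 0 ≤ l) (hal : ∀ i, a i ≤ l) (htl : t * l < 1) :
    ∫ y, Real.exp (t * ((∑ i, a i * ‖y i‖ ^ 2) - 2 * (star β ⬝ᵥ y).re)) ∂(stdComplexGaussian r)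
      ≤ Real.exp (t * ∑ i, a i +
          t ^ 2 * (∑ i, a i ^ 2 + 2 * ∑ i, ‖β i‖ ^ 2) / (2 * (1 - t * l))) := by
  have hle : ∀ i, t * a i ≤ t * l := fun i => mul_le_mul_of_nonneg_left (hal i) ht
  have hpos : 0 < 1 - t * l := by linarith
  have hpos' : ∀ i, 0 < 1 - t * a i := fun i => by linarith [hle i]
  rw [(stdComplexGaussian_exp_diagonal a β t fun i => by linarith [hle i]).2]
  have hrhs : t * ∑ i, a i + t ^ 2 * (∑ i, a i ^ 2 + 2 * ∑ i, ‖β i‖ ^ 2) / (2 * (1 - t * l)) =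
      ∑ i, ((t * a i + (t * a i) ^ 2 / (2 * (1 - t * l))) +
        t ^ 2 * ‖β i‖ ^ 2 / (1 - t * l)) := by
    simp only [mul_pow, Finset.sum_add_distrib, ← Finset.mul_sum, ← Finset.sum_div]
    field_simp
    ring
  rw [hrhs, Real.exp_sum]
  refine Finset.prod_le_prod (fun i _ => ?_) fun i _ => ?_
  · have := hpos' i
    positivity
  · rw [Real.exp_add]
    have := hpos' i
    gcongr
    · have h := neg_log_one_sub_le (hle i) (mul_nonneg ht hl) htl
      rw [← Real.log_inv] at h
      exact (Real.log_le_iff_le_exp (by positivity)).1 h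
    · exact hal i

/-- The Bernstein-type inequality for the diagonal quadratic form `∑ i, a i * ‖y i‖ ^ 2`, where
`l ≥ 0` bounds every `a i`. -/
theorem bernstein_diagonal {r : ℕ} (a : Fin r → ℝ) (β : Fin r → ℂ) {c ρ l : ℝ}
    (hρ0 : 0 < ρ) (hρ1 : ρ ≤ 1) (hl : 0 ≤ l) (hal : ∀ i, a i ≤ l)
    (hc : ∑ i, a i + Real.sqrt (2 * Real.log (1 / ρ)) *
        Real.sqrt (∑ i, a i ^ 2 + 2 * ∑ i, ‖β i‖ ^ 2) - Real.log ρ * l ≤ c) :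
    ENNReal.ofReal (1 - ρ) ≤ stdComplexGaussian r
      {y | (∑ i, a i * ‖y i‖ ^ 2) - 2 * (star β ⬝ᵥ y).re ≤ c} := by
  set X : (Fin r → ℂ) → ℝ := fun y => (∑ i, a i * ‖y i‖ ^ 2) - 2 * (star β ⬝ᵥ y).re with hX
  have hXm : Measurable X := by fun_prop
  have hv0 : 0 ≤ ∑ i, a i ^ 2 + 2 * ∑ i, ‖β i‖ ^ 2 := by positivity
  set v := ∑ i, a i ^ 2 + 2 * ∑ i, ‖β i‖ ^ 2 with hv
  have hlog : Real.log (1 / ρ) = -Real.log ρ := by rw [one_div, Real.log_inv]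
  have hδ : 0 ≤ -Real.log ρ := by linarith [Real.log_nonpos hρ0.le hρ1]
  rcases hv0.eq_or_lt with hv0 | hv0
  · have ha : ∀ i, a i = 0 := by
      have h1 : ∑ i, a i ^ 2 = 0 := by
        have : 0 ≤ ∑ i, a i ^ 2 := by positivity
        have : 0 ≤ ∑ i, ‖β i‖ ^ 2 := by positivity
        linarith
      intro i
      have := (Finset.sum_eq_zero_iff_of_nonneg fun i _ => sq_nonneg (a i)).1 h1 i
        (Finset.mem_univ i)
      exact pow_eq_zero_iff two_ne_zero |>.1 this
    have hb : β = 0 := by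
      have h1 : ∑ i, ‖β i‖ ^ 2 = 0 := by
        have : 0 ≤ ∑ i, a i ^ 2 := by positivity
        have : 0 ≤ ∑ i, ‖β i‖ ^ 2 := by positivity
        linarith
      ext i
      have := (Finset.sum_eq_zero_iff_of_nonneg fun i _ => sq_nonneg ‖β i‖).1 h1 i
        (Finset.mem_univ i)
      simpa using this
    have hc0 : 0 ≤ c := by
      simp only [ha, ← hv0, Real.sqrt_zero, Finset.sum_const_zero] at hc
      nlinarith [mul_nonneg hδ hl]
    have huniv : {y | X y ≤ c} = Set.univ := by
      ext y
      simp [hX, ha, hb, hc0]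
    rw [huniv, measure_univ]
    exact ENNReal.ofReal_le_one.2 (by linarith)
  · set q := Real.sqrt (2 * Real.log (1 / ρ)) with hq
    have hq0 : 0 ≤ q := Real.sqrt_nonneg _
    have hq2 : q ^ 2 = 2 * -Real.log ρ := by rw [hq, Real.sq_sqrt (by linarith), hlog]
    set w := Real.sqrt v with hw
    have hw0 : 0 < w := Real.sqrt_pos.2 hv0
    have hw2 : w ^ 2 = v := Real.sq_sqrt hv0.le
    have hd : 0 < w + l * q := by positivity
    set t := q / (w + l * q) with ht
    have ht0 : 0 ≤ t := by positivity
    have htl : 1 - t * l = w / (w + l * q) := by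
      rw [ht]
      field_simp
      ring
    have htl1 : t * l < 1 := by
      have : 0 < w / (w + l * q) := by positivity
      linarith
    have hint := (stdComplexGaussian_exp_diagonal a β t fun i =>
      (mul_le_mul_of_nonneg_left (hal i) ht0).trans_lt htl1).1
    have hchern := measure_ge_le_exp_mul_mgf c ht0 hint
    have hbad : (stdComplexGaussian r).real {y | c ≤ X y} ≤ ρ := by
      refine hchern.trans ?_
      refine (mul_le_mul_of_nonneg_left (integral_exp_diagonal_le a β ht0 hl hal htl1)
        (Real.exp_pos _).le).trans ?_
      rw [← Real.exp_add, ← hv, ← Real.le_log_iff_exp_le hρ0, htl, ← hw2]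
      have h1 : t ^ 2 * w ^ 2 / (2 * (w / (w + l * q))) =
          t * (q * w + l * q ^ 2 / 2) - q ^ 2 / 2 := by
        rw [ht]
        field_simp
        ring
      rw [h1]
      have h2 := mul_le_mul_of_nonneg_left hc ht0
      have h3 : Real.log ρ = -(q ^ 2 / 2) := by linarith
      rw [h3] at h2 ⊢
      linarith
    have hms : MeasurableSet {y | X y ≤ c} := measurableSet_le hXm measurable_const
    have hcompl : (stdComplexGaussian r).real {y | X y ≤ c}ᶜ ≤ ρ := by
      refine (measureReal_mono ?_).trans hbad
      intro y hy
      exact (lt_of_not_ge hy : c < X y).le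
    rw [probReal_compl_eq_one_sub hms] at hcompl
    refine ENNReal.ofReal_le_of_le_toReal ?_
    change 1 - ρ ≤ (stdComplexGaussian r).real {y | X y ≤ c}
    linarith

theorem sum_norm_sq_eq_sum_sq_eigenvalues {r : ℕ} {A : Matrix (Fin r) (Fin r) ℂ}
    (hA : A.IsHermitian) : ∑ i, ∑ j, ‖A i j‖ ^ 2 = ∑ i, hA.eigenvalues i ^ 2 := by
  have h1 : ((∑ i, ∑ j, ‖A i j‖ ^ 2 : ℝ) : ℂ) = (A * Aᴴ).trace := by
    simp only [trace, diag_apply, mul_apply, conjTranspose_apply]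
    push_cast
    refine Finset.sum_congr rfl fun i _ => Finset.sum_congr rfl fun j _ => ?_
    rw [Complex.star_def, Complex.mul_conj']
  have h2 : (A * Aᴴ).trace = ((∑ i, hA.eigenvalues i ^ 2 : ℝ) : ℂ) := by
    rw [hA.eq]
    conv_lhs => rw [hA.spectral_theorem]
    rw [← map_mul, Unitary.conjStarAlgAut_apply, trace_mul_cycle, Unitary.coe_star_mul_self,
      one_mul, diagonal_mul_diagonal, trace_diagonal]
    push_cast
    exact Finset.sum_congr rfl fun i _ => by simp [sq]
  exact_mod_cast h1.trans h2

theorem star_dotProduct_mulVec_eq_sum_eigenvalues {r : ℕ} {A : Matrix (Fin r) (Fin r) ℂ}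
    (hA : A.IsHermitian) (x : Fin r → ℂ) :
    (star x ⬝ᵥ A *ᵥ x).re = ∑ i, hA.eigenvalues i *
      ‖((hA.eigenvectorUnitary : Matrix (Fin r) (Fin r) ℂ)ᴴ *ᵥ x) i‖ ^ 2 := by
  set U : Matrix (Fin r) (Fin r) ℂ := ↑hA.eigenvectorUnitary
  have h : A *ᵥ x = U *ᵥ (diagonal (RCLike.ofReal ∘ hA.eigenvalues) *ᵥ (Uᴴ *ᵥ x)) := by
    conv_lhs => rw [hA.spectral_theorem, Unitary.conjStarAlgAut_apply]
    rw [mulVec_mulVec, mulVec_mulVec, star_eq_conjTranspose]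
  have h' := star_mulVec_dotProduct Uᴴ x (diagonal (RCLike.ofReal ∘ hA.eigenvalues) *ᵥ (Uᴴ *ᵥ x))
  rw [conjTranspose_conjTranspose] at h'
  rw [h, ← h']
  simp only [dotProduct, mulVec_diagonal, Complex.re_sum, Pi.star_apply]
  refine Finset.sum_congr rfl fun i _ => ?_
  simp [Complex.sq_norm, Complex.normSq_apply]
  ring

/-- **Bernstein-Type Inequality.** For a Hermitian `B`, `b ∈ ℂʳ`, `c ∈ ℝ` and `ρ ∈ (0,1]`, if
`Tr(B) − √(2 ln(1/ρ))·√(‖B‖_F² + 2‖b‖₂²) + ln(ρ)·max(λ_max(−B), 0) + c ≥ 0`, then for a standard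
circularly symmetric complex Gaussian vector `x`,
`Pr{ xᴴ B x + 2 Re(bᴴ x) + c ≥ 0 } ≥ 1 − ρ`. -/
theorem bernstein_type_inequality {r : ℕ} (B : Matrix (Fin r) (Fin r) ℂ)
    (hB : B.IsHermitian) (b : Fin r → ℂ) (c ρ : ℝ) (hρ0 : 0 < ρ) (hρ1 : ρ ≤ 1)
    (hcond :
      0 ≤ B.trace.re
          - Real.sqrt (2 * Real.log (1 / ρ)) *
              Real.sqrt ((∑ i, ∑ j, ‖B i j‖ ^ 2) + 2 * ∑ i, ‖b i‖ ^ 2)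
          + Real.log ρ * max (⨆ i, (hB.neg).eigenvalues i) 0 + c) :
    ENNReal.ofReal (1 - ρ) ≤
      stdComplexGaussian r
        {x | 0 ≤ (star x ⬝ᵥ B.mulVec x).re + 2 * (star b ⬝ᵥ x).re + c} := by
  set hA := hB.neg
  set V : Matrix (Fin r) (Fin r) ℂ :=
    (hA.eigenvectorUnitary : Matrix (Fin r) (Fin r) ℂ)ᴴ with hVdef
  have hV : V * Vᴴ = 1 := by
    rw [hVdef, conjTranspose_conjTranspose, ← star_eq_conjTranspose, Unitary.coe_star_mul_self]
  have hV' : Vᴴ * V = 1 := mul_eq_one_comm.1 hV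
  have hdot : ∀ x y, star (V *ᵥ x) ⬝ᵥ (V *ᵥ y) = star x ⬝ᵥ y := fun x y => by
    rw [star_mulVec_dotProduct, mulVec_mulVec, hV', one_mulVec]
  have hset : {x | 0 ≤ (star x ⬝ᵥ B.mulVec x).re + 2 * (star b ⬝ᵥ x).re + c} =
      (fun x => V *ᵥ x) ⁻¹' {y | (∑ i, hA.eigenvalues i * ‖y i‖ ^ 2) -
        2 * (star (V *ᵥ b) ⬝ᵥ y).re ≤ c} := by
    ext x
    have h := star_dotProduct_mulVec_eq_sum_eigenvalues hA x
    rw [neg_mulVec, dotProduct_neg, Complex.neg_re] at h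
    simp only [Set.mem_ofPred_eq, Set.mem_preimage, hdot]
    rw [← h]
    constructor <;> intro h' <;> linarith
  have hm : Measurable (fun x : Fin r → ℂ => V *ᵥ x) :=
    (Continuous.matrix_mulVec continuous_const continuous_id).measurable
  rw [hset, ← Measure.map_apply hm (measurableSet_le (by fun_prop) measurable_const),
    map_mulVec_stdComplexGaussian hV]
  refine bernstein_diagonal _ _ hρ0 hρ1 (le_max_right (⨆ i, hA.eigenvalues i) 0)
    (fun i => (le_ciSup (Set.finite_range _).bddAbove i).trans (le_max_left _ _)) ?_
  have htr : B.trace.re = -∑ i, hA.eigenvalues i := by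
    have h := congrArg Complex.re hA.trace_eq_sum_eigenvalues
    rw [trace_neg, Complex.neg_re] at h
    simp only [Complex.re_sum, Complex.coe_algebraMap, Complex.ofReal_re] at h
    linarith
  have hfro : ∑ i, ∑ j, ‖B i j‖ ^ 2 = ∑ i, hA.eigenvalues i ^ 2 := by
    rw [← sum_norm_sq_eq_sum_sq_eigenvalues hA]
    simp
  have hnorm : ∑ i, ‖(V *ᵥ b) i‖ ^ 2 = ∑ i, ‖b i‖ ^ 2 := by
    have hre : ∀ z : Fin r → ℂ, ∑ i, ‖z i‖ ^ 2 = (star z ⬝ᵥ z).re := fun z => by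
      simp [dotProduct, Complex.sq_norm, Complex.normSq_apply]
    rw [hre, hre, hdot]
  rw [hnorm, ← hfro]
  linarith
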